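/- arXiv:1709.00706 — 4 statements merged into one kernel-verified Lean document; each statement's English description precedes it below -/
import Mathlib

section
/- Let Γ be a connected simple graph on a nonempty vertex type α satisfying the NDC condition. Then there exists a partition P of α such that: (i) every part of P induces a complete or an empty subgraph of Γ; (ii) every part M is a module: for all x, y ∈ M and z ∉ M, z is adjacent to x iff z is adjacent to y; (iii) the decomposition is reduced: for all distinct parts M₁, M₂ such that for every part M other than M₁ and M₂, (some vertex of M is adjacent to some vertex of M₁) iff (some vertex of M is adjacent to some vertex of M₂), one has: if no vertex of M₁ is adjacent to a vertex of M₂ then M₁ or M₂ contains two adjacent vertices, and if some vertex of M₁ is adjacent to a vertex of M₂ then M₁ or M₂ contains two distinct non-adjacent vertices. -/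
/-- The common neighborhood of a set `U` of vertices: vertices adjacent to every element of `U`. -/
def commonNbhd {α : Type*} (Γ : SimpleGraph α) (U : Set α) : Set α :=
  {v | ∀ u ∈ U, Γ.Adj v u}

/-- The NDC condition: for every nonempty chain of vertex subsets each of which has nonempty
common neighborhood, the intersection of the common neighborhoods is nonempty. -/
def NDC {α : Type*} (Γ : SimpleGraph α) : Prop :=
  ∀ S : Set (Set α), S.Nonempty → IsChain (· ⊆ ·) S →
    (∀ U ∈ S, (commonNbhd Γ U).Nonempty) → (⋂ U ∈ S, commonNbhd Γ U).Nonempty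

/-- Two vertices are twins if no third vertex distinguishes them. -/
def twinSetoid {α : Type*} (Γ : SimpleGraph α) : Setoid α where
  r x y := ∀ z, z ≠ x → z ≠ y → (Γ.Adj z x ↔ Γ.Adj z y)
  iseqv :=
    { refl := fun _ _ _ _ => Iff.rfl
      symm := fun h z hx hy => (h z hy hx).symm
      trans := by
        intro x y z hxy hyz w hwx hwz
        by_cases hwy : w = y
        · subst hwy
          have h₁ := hxy z
          have h₂ := hyz x
          have h₃ := Γ.adj_comm x z
          have h₄ := Γ.adj_comm x w
          have h₅ := Γ.adj_comm w z
          grind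
        · exact (hxy w hwx hwy).trans (hyz w hwy hwz) }

/-- A set of pairwise twins induces a complete or an empty subgraph. -/
theorem complete_or_empty_of_twins {α : Type*} {Γ : SimpleGraph α} {M : Set α}
    (hM : ∀ x ∈ M, ∀ y ∈ M, twinSetoid Γ x y) :
    (∀ x ∈ M, ∀ y ∈ M, x ≠ y → Γ.Adj x y) ∨ (∀ x ∈ M, ∀ y ∈ M, ¬ Γ.Adj x y) := by
  by_contra! h
  obtain ⟨⟨u, hu, v, hv, huv, hnadj⟩, x, hx, y, hy, hadj⟩ := h
  have slide : ∀ a ∈ M, ∀ b ∈ M, ∀ c, c ≠ b → Γ.Adj c a → Γ.Adj c b :=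
    fun a ha b hb c hcb hca => (hM a ha b hb c hca.ne hcb).1 hca
  obtain ⟨d, hd, hud⟩ : ∃ d ∈ M, Γ.Adj u d := by
    by_cases hxu : x = u
    · exact ⟨y, hy, hxu ▸ hadj⟩
    · exact ⟨x, hx, (slide y hy u hu x hxu hadj).symm⟩
  exact hnadj (slide d hd v hv u huv hud)

/-- Vertices in two disjoint modules are adjacent as soon as some vertices
of these modules are. -/
theorem adj_of_adj_of_modules {α : Type*} {Γ : SimpleGraph α} {M N : Set α}
    (hM : ∀ x ∈ M, ∀ y ∈ M, ∀ z ∉ M, (Γ.Adj z x ↔ Γ.Adj z y))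
    (hN : ∀ x ∈ N, ∀ y ∈ N, ∀ z ∉ N, (Γ.Adj z x ↔ Γ.Adj z y)) (hMN : Disjoint M N)
    (h : ∃ u ∈ M, ∃ v ∈ N, Γ.Adj u v) {x y : α} (hx : x ∈ M) (hy : y ∈ N) : Γ.Adj x y := by
  obtain ⟨u, hu, v, hv, huv⟩ := h
  have hxv := (hM u hu x hx v (hMN.notMem_of_mem_right hv)).1 huv.symm
  exact (hN v hv y hy x (hMN.notMem_of_mem_left hx)).1 hxv.symm

/-- Every connected NDC graph can be written as a reduced complete-empty `X`-join: there is a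
partition of the vertices into complete-or-empty modules which is reduced. -/
theorem exists_reduced_complete_empty_decomposition {α : Type*} [Nonempty α]
    (Γ : SimpleGraph α) (hconn : Γ.Connected) (hndc : NDC Γ) :
    ∃ P : Set (Set α), Setoid.IsPartition P ∧
      (∀ M ∈ P, (∀ x ∈ M, ∀ y ∈ M, x ≠ y → Γ.Adj x y) ∨ (∀ x ∈ M, ∀ y ∈ M, ¬ Γ.Adj x y)) ∧
      (∀ M ∈ P, ∀ x ∈ M, ∀ y ∈ M, ∀ z ∉ M, (Γ.Adj z x ↔ Γ.Adj z y)) ∧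
      (∀ M₁ ∈ P, ∀ M₂ ∈ P, M₁ ≠ M₂ →
        (∀ M ∈ P, M ≠ M₁ → M ≠ M₂ →
          ((∃ u ∈ M, ∃ v ∈ M₁, Γ.Adj u v) ↔ (∃ u ∈ M, ∃ v ∈ M₂, Γ.Adj u v))) →
        ((¬ ∃ u ∈ M₁, ∃ v ∈ M₂, Γ.Adj u v) →
          (∃ x ∈ M₁, ∃ y ∈ M₁, Γ.Adj x y) ∨ (∃ x ∈ M₂, ∃ y ∈ M₂, Γ.Adj x y)) ∧
        ((∃ u ∈ M₁, ∃ v ∈ M₂, Γ.Adj u v) →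
          (∃ x ∈ M₁, ∃ y ∈ M₁, x ≠ y ∧ ¬ Γ.Adj x y) ∨
          (∃ x ∈ M₂, ∃ y ∈ M₂, x ≠ y ∧ ¬ Γ.Adj x y))) := by
  have twins : ∀ M ∈ (twinSetoid Γ).classes, ∀ x ∈ M, ∀ y ∈ M, twinSetoid Γ x y := by
    rintro M ⟨a, rfl⟩ x hx y hy
    exact (twinSetoid Γ).trans hx ((twinSetoid Γ).symm hy)
  have eq_of_twins : ∀ M ∈ (twinSetoid Γ).classes, ∀ N ∈ (twinSetoid Γ).classes,
      ∀ x ∈ M, ∀ y ∈ N, twinSetoid Γ x y → M = N := by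
    rintro M hM N ⟨b, rfl⟩ x hx y hy hxy
    exact Setoid.eq_of_mem_classes hM hx ⟨b, rfl⟩ ((twinSetoid Γ).trans hxy hy)
  have modules : ∀ M ∈ (twinSetoid Γ).classes, ∀ x ∈ M, ∀ y ∈ M, ∀ z ∉ M,
      (Γ.Adj z x ↔ Γ.Adj z y) := fun M hM x hx y hy z hz =>
    twins M hM x hx y hy z (fun h => hz (h ▸ hx)) (fun h => hz (h ▸ hy))
  have part := Setoid.isPartition_classes (twinSetoid Γ)
  have disj : ∀ M ∈ (twinSetoid Γ).classes, ∀ N ∈ (twinSetoid Γ).classes, M ≠ N →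
      Disjoint M N := fun M hM N hN hne => part.pairwiseDisjoint hM hN hne
  refine ⟨(twinSetoid Γ).classes, part,
    fun M hM => complete_or_empty_of_twins (twins M hM), modules, ?_⟩
  intro M₁ h₁ M₂ h₂ hne hsame
  obtain ⟨x, hx⟩ := Setoid.nonempty_of_mem_partition part h₁
  obtain ⟨y, hy⟩ := Setoid.nonempty_of_mem_partition part h₂
  have outside : ∀ z, z ∉ M₁ → z ∉ M₂ → (Γ.Adj z x ↔ Γ.Adj z y) := by
    intro z hz₁ hz₂
    obtain ⟨M, ⟨hM, hzM⟩, -⟩ := part.2 z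
    have hM₁ : M ≠ M₁ := fun h => hz₁ (h ▸ hzM)
    have hM₂ : M ≠ M₂ := fun h => hz₂ (h ▸ hzM)
    have key := hsame M hM hM₁ hM₂
    exact ⟨fun h => adj_of_adj_of_modules (modules M hM) (modules M₂ h₂) (disj M hM M₂ h₂ hM₂)
        (key.1 ⟨z, hzM, x, hx, h⟩) hzM hy,
      fun h => adj_of_adj_of_modules (modules M hM) (modules M₁ h₁) (disj M hM M₁ h₁ hM₁)
        (key.2 ⟨z, hzM, y, hy, h⟩) hzM hx⟩
  constructor
  · intro hno
    by_contra! hempty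
    refine hne (eq_of_twins M₁ h₁ M₂ h₂ x hx y hy fun z _ _ => ?_)
    by_cases hz₁ : z ∈ M₁
    · exact iff_of_false (hempty.1 z hz₁ x hx) fun h => hno ⟨z, hz₁, y, hy, h⟩
    by_cases hz₂ : z ∈ M₂
    · exact iff_of_false (fun h => hno ⟨x, hx, z, hz₂, h.symm⟩) (hempty.2 z hz₂ y hy)
    exact outside z hz₁ hz₂
  · intro hadj
    by_contra! hcomplete
    have cross : ∀ u ∈ M₁, ∀ v ∈ M₂, Γ.Adj u v := fun u hu v hv =>
      adj_of_adj_of_modules (modules M₁ h₁) (modules M₂ h₂) (disj M₁ h₁ M₂ h₂ hne) hadj hu hv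
    refine hne (eq_of_twins M₁ h₁ M₂ h₂ x hx y hy fun z hzx hzy => ?_)
    by_cases hz₁ : z ∈ M₁
    · exact iff_of_true (hcomplete.1 z hz₁ x hx hzx) (cross z hz₁ y hy)
    by_cases hz₂ : z ∈ M₂
    · exact iff_of_true (cross x hx z hz₂).symm (hcomplete.2 z hz₂ y hy hzy)
    exact outside z hz₁ hz₂
end

section
/- Let Γ be a simple graph on vertex type α and let S be a nonempty collection of subsets of α, totally ordered by inclusion, with S ⊆ CE_m(Γ). If the intersection ⋂_{U ∈ S} N(U) of their common neighborhoods is nonempty, then the union ⋃ S belongs to CE_m(Γ). -/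
/-- The collection `CE_m(Γ)`: sets `U` with nonempty common neighborhood, inducing a complete or
an empty subgraph, and such that `N(x) \ {y} = N(y) \ {x}` for all `x, y ∈ U`. -/
def CEm {α : Type*} (Γ : SimpleGraph α) : Set (Set α) :=
  {U | (commonNbhd Γ U).Nonempty ∧
    ((∀ x ∈ U, ∀ y ∈ U, x ≠ y → Γ.Adj x y) ∨ (∀ x ∈ U, ∀ y ∈ U, ¬ Γ.Adj x y)) ∧
    (∀ x ∈ U, ∀ y ∈ U, Γ.neighborSet x \ {y} = Γ.neighborSet y \ {x})}

/-- The union of a nonempty chain in `CE_m(Γ)` whose common neighborhoods have nonempty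
intersection again belongs to `CE_m(Γ)`. -/
theorem sUnion_chain_mem_CEm {α : Type*} (Γ : SimpleGraph α) (S : Set (Set α))
    (hne : S.Nonempty) (hchain : IsChain (· ⊆ ·) S) (hS : S ⊆ CEm Γ)
    (hint : (⋂ U ∈ S, commonNbhd Γ U).Nonempty) :
    ⋃₀ S ∈ CEm Γ := by
  have common : ∀ x ∈ ⋃₀ S, ∀ y ∈ ⋃₀ S, ∃ U ∈ S, x ∈ U ∧ y ∈ U := by
    rintro x ⟨U, hU, hx⟩ y ⟨V, hV, hy⟩
    rcases hchain.total hU hV with h | h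
    · exact ⟨V, hV, h hx, hy⟩
    · exact ⟨U, hU, hx, h hy⟩
  refine ⟨?_, ?_, ?_⟩
  · obtain ⟨v, hv⟩ := hint
    refine ⟨v, ?_⟩
    rintro u ⟨U, hU, hu⟩
    exact Set.mem_iInter₂.mp hv U hU u hu
  · by_contra! h
    obtain ⟨⟨x, hx, y, hy, hxy, hnadj⟩, a, ha, b, hb, hadj⟩ := h
    obtain ⟨U, hU, hxU, hyU⟩ := common x hx y hy
    obtain ⟨V, hV, haV, hbV⟩ := common a ha b hb
    rcases hchain.total hU hV with h | h
    · rcases (hS hV).2.1 with hc | he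
      · exact hnadj (hc x (h hxU) y (h hyU) hxy)
      · exact he a haV b hbV hadj
    · rcases (hS hU).2.1 with hc | he
      · exact hnadj (hc x hxU y hyU hxy)
      · exact he a (h haV) b (h hbV) hadj
  · intro x hx y hy
    obtain ⟨U, hU, hxU, hyU⟩ := common x hx y hy
    exact (hS hU).2.2 x hxU y hyU
end

section
/- Let Γ be a connected simple graph that is not complete. If M₁ and M₂ are both maximal elements of CE_m(Γ) with respect to set inclusion and M₁ ∩ M₂ ≠ ∅, then M₁ = M₂. Consequently the maximal elements of CE_m(Γ) are pairwise disjoint. -/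
/-- A connected graph has an edge leaving any nonempty proper set of vertices. -/
theorem SimpleGraph.Preconnected.exists_adj_mem_notMem {α : Type*} {Γ : SimpleGraph α}
    (hconn : Γ.Preconnected) {S : Set α} {a b : α} (ha : a ∈ S) (hb : b ∉ S) :
    ∃ c ∈ S, ∃ w ∉ S, Γ.Adj c w := by
  obtain ⟨p⟩ := hconn a b
  obtain ⟨d, -, h₁, h₂⟩ := p.exists_boundary_dart S ha hb
  exact ⟨d.fst, h₁, d.snd, h₂, d.adj⟩

/-- Two vertices are twins if they have the same neighbors apart from each other. -/
def SimpleGraph.IsTwin {α : Type*} (Γ : SimpleGraph α) (x y : α) : Prop :=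
  ∀ w, w ≠ x → w ≠ y → (Γ.Adj x w ↔ Γ.Adj y w)

namespace SimpleGraph.IsTwin

variable {α : Type*} {Γ : SimpleGraph α} {x y z w : α}

theorem refl (Γ : SimpleGraph α) (x : α) : Γ.IsTwin x x := fun _ _ _ => Iff.rfl

theorem symm (h : Γ.IsTwin x y) : Γ.IsTwin y x := fun w hy hx => (h w hx hy).symm

theorem trans (h₁ : Γ.IsTwin x y) (h₂ : Γ.IsTwin y z) : Γ.IsTwin x z := by
  intro w hx hz
  by_cases hxz : x = z
  · rw [hxz]
  by_cases hwy : w = y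
  · subst hwy
    rw [Γ.adj_comm x w, h₂ x hx.symm hxz, Γ.adj_comm z x, h₁ z (Ne.symm hxz) hz.symm,
      Γ.adj_comm w z]
  · exact (h₁ w hx hwy).trans (h₂ w hwy hz)

theorem neighborSet_sdiff_singleton_eq_iff :
    Γ.neighborSet x \ {y} = Γ.neighborSet y \ {x} ↔ Γ.IsTwin x y := by
  constructor
  · intro h w hx hy
    simpa [hx, hy] using Set.ext_iff.mp h w
  · intro h
    ext w
    have := h w
    have := Γ.ne_of_adj (a := x) (b := w)
    have := Γ.ne_of_adj (a := y) (b := w)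
    simp only [Set.mem_sdiff, mem_neighborSet, Set.mem_singleton_iff]
    grind

/-- A vertex with an adjacent twin is adjacent to all of its twins. -/
theorem adj_of_adj (hxy : Γ.IsTwin x y) (hxz : Γ.IsTwin x z) (h : Γ.Adj x y) (hne : x ≠ z) :
    Γ.Adj x z := by
  have := hxy z
  have := hxz y
  grind [Γ.adj_comm y z, Γ.ne_of_adj h]

/-- A twin class is a clique or an independent set. -/
theorem complete_or_empty (Γ : SimpleGraph α) (z : α) :
    (∀ x ∈ {v | Γ.IsTwin z v}, ∀ y ∈ {v | Γ.IsTwin z v}, x ≠ y → Γ.Adj x y) ∨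
      (∀ x ∈ {v | Γ.IsTwin z v}, ∀ y ∈ {v | Γ.IsTwin z v}, ¬ Γ.Adj x y) := by
  by_contra! ⟨⟨a, ha, b, hb, hab, hnadj⟩, c, hc, d, hd, hcd⟩
  have hac := ha.symm.trans hc
  have hab' := ha.symm.trans hb
  refine hnadj ?_
  by_cases hca : c = a
  · subst hca
    exact (ha.symm.trans hd).adj_of_adj hab' hcd hab
  · have := (hc.symm.trans hd).adj_of_adj hac.symm hcd hca
    exact hac.adj_of_adj hab' this.symm hab

end SimpleGraph.IsTwin

/-- In a connected non-complete graph every twin class belongs to `CE_m(Γ)`. -/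
theorem twinClass_mem_CEm {α : Type*} {Γ : SimpleGraph α} (hconn : Γ.Preconnected)
    (hnc : ¬ ∀ x y : α, x ≠ y → Γ.Adj x y) (z : α) : {v | Γ.IsTwin z v} ∈ CEm Γ := by
  have hce := SimpleGraph.IsTwin.complete_or_empty Γ z
  refine ⟨?_, hce, fun x hx y hy =>
    SimpleGraph.IsTwin.neighborSet_sdiff_singleton_eq_iff.2 (hx.symm.trans hy)⟩
  obtain ⟨b, hb⟩ : ∃ b, ¬ Γ.IsTwin z b := by
    by_contra! hall
    rcases hce with h | h
    · exact hnc fun x y => h x (hall x) y (hall y)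
    · push Not at hnc
      obtain ⟨x, y, hxy, -⟩ := hnc
      obtain ⟨c, -, w, -, hcw⟩ :=
        hconn.exists_adj_mem_notMem (Set.mem_singleton x) (b := y) (by simpa using hxy.symm)
      exact h c (hall c) w (hall w) hcw
  obtain ⟨c, hc, w, hw, hcw⟩ := hconn.exists_adj_mem_notMem
    (S := {v | Γ.IsTwin z v}) (SimpleGraph.IsTwin.refl Γ z) hb
  refine ⟨w, fun u hu => ((hc.symm.trans hu w ?_ ?_).1 hcw).symm⟩
  · rintro rfl
    exact hw hc
  · rintro rfl
    exact hw hu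

/-- A member of `CE_m(Γ)` is contained in the twin class of each of its vertices. -/
theorem subset_twinClass_of_mem_CEm {α : Type*} {Γ : SimpleGraph α} {M : Set α} {z : α}
    (hM : M ∈ CEm Γ) (hz : z ∈ M) : M ⊆ {v | Γ.IsTwin z v} := fun v hv =>
  SimpleGraph.IsTwin.neighborSet_sdiff_singleton_eq_iff.1 (hM.2.2 z hz v hv)

/-- In a connected non-complete graph, distinct maximal elements of `CE_m(Γ)` are disjoint:
if two maximal elements of `CE_m(Γ)` intersect, they are equal. -/
theorem maximal_CEm_eq_of_inter_nonempty {α : Type*} (Γ : SimpleGraph α)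
    (hconn : Γ.Connected) (hnc : ¬ ∀ x y : α, x ≠ y → Γ.Adj x y)
    (M₁ M₂ : Set α)
    (h₁ : M₁ ∈ CEm Γ ∧ ∀ U ∈ CEm Γ, M₁ ⊆ U → U = M₁)
    (h₂ : M₂ ∈ CEm Γ ∧ ∀ U ∈ CEm Γ, M₂ ⊆ U → U = M₂)
    (hint : (M₁ ∩ M₂).Nonempty) :
    M₁ = M₂ := by
  obtain ⟨z, hz₁, hz₂⟩ := hint
  have hC := twinClass_mem_CEm hconn.preconnected hnc z
  exact (h₁.2 _ hC (subset_twinClass_of_mem_CEm h₁.1 hz₁)).symm.trans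
    (h₂.2 _ hC (subset_twinClass_of_mem_CEm h₂.1 hz₂))
end

section
/- Let Γ be a connected simple graph. If P₁ and P₂ are both reduced complete-empty join decompositions of Γ, then P₁ = P₂. -/
/-- A reduced complete-empty join decomposition of a simple graph `Γ`: a partition of the
vertices into complete-or-empty modules which is reduced. -/
def IsReducedCEDecomp {α : Type*} (Γ : SimpleGraph α) (P : Set (Set α)) : Prop :=
  Setoid.IsPartition P ∧
  (∀ M ∈ P, (∀ x ∈ M, ∀ y ∈ M, x ≠ y → Γ.Adj x y) ∨ (∀ x ∈ M, ∀ y ∈ M, ¬ Γ.Adj x y)) ∧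
  (∀ M ∈ P, ∀ x ∈ M, ∀ y ∈ M, ∀ z ∉ M, (Γ.Adj z x ↔ Γ.Adj z y)) ∧
  (∀ M₁ ∈ P, ∀ M₂ ∈ P, M₁ ≠ M₂ →
    (∀ M ∈ P, M ≠ M₁ → M ≠ M₂ →
      ((∃ u ∈ M, ∃ v ∈ M₁, Γ.Adj u v) ↔ (∃ u ∈ M, ∃ v ∈ M₂, Γ.Adj u v))) →
    ((¬ ∃ u ∈ M₁, ∃ v ∈ M₂, Γ.Adj u v) →
      (∃ x ∈ M₁, ∃ y ∈ M₁, Γ.Adj x y) ∨ (∃ x ∈ M₂, ∃ y ∈ M₂, Γ.Adj x y)) ∧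
    ((∃ u ∈ M₁, ∃ v ∈ M₂, Γ.Adj u v) →
      (∃ x ∈ M₁, ∃ y ∈ M₁, x ≠ y ∧ ¬ Γ.Adj x y) ∨
      (∃ x ∈ M₂, ∃ y ∈ M₂, x ≠ y ∧ ¬ Γ.Adj x y)))

/-- Two vertices are twins if no third vertex distinguishes them. -/
def SimpleGraph.AreTwins {α : Type*} (Γ : SimpleGraph α) (x y : α) : Prop :=
  ∀ z, z ≠ x → z ≠ y → (Γ.Adj z x ↔ Γ.Adj z y)

lemma SimpleGraph.AreTwins.symm {α : Type*} {Γ : SimpleGraph α} {x y : α}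
    (h : Γ.AreTwins x y) : Γ.AreTwins y x :=
  fun z hy hx => (h z hx hy).symm

/-- A complete-or-empty module containing two adjacent vertices cannot contain exactly one of
two non-adjacent twins. -/
lemma SimpleGraph.AreTwins.false_of_not_adj {α : Type*} {Γ : SimpleGraph α} {M : Set α}
    {x y : α} (hce : (∀ x ∈ M, ∀ y ∈ M, x ≠ y → Γ.Adj x y) ∨ (∀ x ∈ M, ∀ y ∈ M, ¬ Γ.Adj x y))
    (hmod : ∀ x ∈ M, ∀ y ∈ M, ∀ z ∉ M, (Γ.Adj z x ↔ Γ.Adj z y))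
    (hx : x ∈ M) (hy : y ∉ M) (h : Γ.AreTwins x y) (hxy : ¬ Γ.Adj x y)
    (hM : ∃ a ∈ M, ∃ b ∈ M, Γ.Adj a b) : False := by
  obtain ⟨a, ha, b, hb, hab⟩ := hM
  have hcomplete := hce.resolve_right fun he => he a ha b hb hab
  obtain ⟨c, hc, hcx⟩ : ∃ c ∈ M, c ≠ x := by
    by_cases hax : a = x
    · exact ⟨b, hb, fun hbx => hab.ne (hax.trans hbx.symm)⟩
    · exact ⟨a, ha, hax⟩
  have hcy := (h c hcx fun e => hy (e ▸ hc)).1 (hcomplete c hc x hx hcx)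
  exact hxy ((hmod c hc x hx y hy).1 hcy.symm).symm

/-- A complete-or-empty module containing two distinct non-adjacent vertices cannot contain
exactly one of two adjacent twins. -/
lemma SimpleGraph.AreTwins.false_of_adj {α : Type*} {Γ : SimpleGraph α} {M : Set α}
    {x y : α} (hce : (∀ x ∈ M, ∀ y ∈ M, x ≠ y → Γ.Adj x y) ∨ (∀ x ∈ M, ∀ y ∈ M, ¬ Γ.Adj x y))
    (hmod : ∀ x ∈ M, ∀ y ∈ M, ∀ z ∉ M, (Γ.Adj z x ↔ Γ.Adj z y))
    (hx : x ∈ M) (hy : y ∉ M) (h : Γ.AreTwins x y) (hxy : Γ.Adj x y)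
    (hM : ∃ a ∈ M, ∃ b ∈ M, a ≠ b ∧ ¬ Γ.Adj a b) : False := by
  obtain ⟨a, ha, b, hb, hne, hab⟩ := hM
  have hempty := hce.resolve_left fun hc => hab (hc a ha b hb hne)
  obtain ⟨c, hc, hcx⟩ : ∃ c ∈ M, c ≠ x := by
    by_cases hax : a = x
    · exact ⟨b, hb, fun hbx => hne (hax.trans hbx.symm)⟩
    · exact ⟨a, ha, hax⟩
  have hyc := (hmod x hx c hc y hy).1 hxy.symm
  exact hempty c hc x hx ((h c hcx fun e => hy (e ▸ hc)).2 hyc.symm)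

/-- Two vertices lie in the same part of a reduced complete-empty join decomposition exactly
when they are twins. -/
lemma IsReducedCEDecomp.mem_iff_areTwins {α : Type*} {Γ : SimpleGraph α} {P : Set (Set α)}
    (h : IsReducedCEDecomp Γ P) {M : Set α} (hM : M ∈ P) {x y : α} (hx : x ∈ M) :
    y ∈ M ↔ Γ.AreTwins x y := by
  obtain ⟨⟨-, hpart⟩, hce, hmod, hred⟩ := h
  constructor
  · intro hy z hzx hzy
    by_cases hz : z ∈ M
    · rcases hce M hM with hc | he
      · exact iff_of_true (hc z hz x hx hzx) (hc z hz y hy hzy)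
      · exact iff_of_false (he z hz x hx) (he z hz y hy)
    · exact hmod M hM x hx y hy z hz
  · intro htw
    by_contra hy
    obtain ⟨N, ⟨hN, hyN⟩, -⟩ := hpart y
    have hMN : M ≠ N := fun e => hy (e ▸ hyN)
    have hdisj : ∀ A ∈ P, ∀ B ∈ P, A ≠ B → ∀ a ∈ A, a ∉ B := fun A hA B hB hAB a ha hb =>
      hAB ((hpart a).unique ⟨hA, ha⟩ ⟨hB, hb⟩)
    have hxN : x ∉ N := hdisj M hM N hN hMN x hx
    have hnbr : ∀ L ∈ P, L ≠ M → L ≠ N →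
        ((∃ u ∈ L, ∃ v ∈ M, Γ.Adj u v) ↔ (∃ u ∈ L, ∃ v ∈ N, Γ.Adj u v)) := by
      intro L hL hLM hLN
      have huM := hdisj L hL M hM hLM
      have huN := hdisj L hL N hN hLN
      have htw' : ∀ u ∈ L, (Γ.Adj u x ↔ Γ.Adj u y) := fun u hu =>
        htw u (fun e => huM u hu (e ▸ hx)) (fun e => huN u hu (e ▸ hyN))
      constructor
      · rintro ⟨u, hu, v, hv, huv⟩
        exact ⟨u, hu, y, hyN, (htw' u hu).1 ((hmod M hM v hv x hx u (huM u hu)).1 huv)⟩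
      · rintro ⟨u, hu, v, hv, huv⟩
        exact ⟨u, hu, x, hx, (htw' u hu).2 ((hmod N hN v hv y hyN u (huN u hu)).1 huv)⟩
    obtain ⟨hnonadj, hadj⟩ := hred M hM N hN hMN hnbr
    by_cases hxy : Γ.Adj x y
    · rcases hadj ⟨x, hx, y, hyN, hxy⟩ with hbad | hbad
      · exact htw.false_of_adj (hce M hM) (hmod M hM) hx hy hxy hbad
      · exact htw.symm.false_of_adj (hce N hN) (hmod N hN) hyN hxN hxy.symm hbad
    · have hno : ¬ ∃ u ∈ M, ∃ v ∈ N, Γ.Adj u v := by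
        rintro ⟨u, hu, v, hv, huv⟩
        have huy := (hmod N hN v hv y hyN u (hdisj M hM N hN hMN u hu)).1 huv
        exact hxy ((hmod M hM u hu x hx y hy).1 huy.symm).symm
      rcases hnonadj hno with hbad | hbad
      · exact htw.false_of_not_adj (hce M hM) (hmod M hM) hx hy hxy hbad
      · exact htw.symm.false_of_not_adj (hce N hN) (hmod N hN) hyN hxN
          (fun e => hxy e.symm) hbad

lemma IsReducedCEDecomp.subset {α : Type*} {Γ : SimpleGraph α} {P Q : Set (Set α)}
    (hP : IsReducedCEDecomp Γ P) (hQ : IsReducedCEDecomp Γ Q) : P ⊆ Q := by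
  intro M hM
  obtain ⟨x, hx⟩ := Setoid.nonempty_of_mem_partition hP.1 hM
  obtain ⟨N, ⟨hN, hxN⟩, -⟩ := hQ.1.2 x
  have hMN : M = N := Set.ext fun y =>
    (hP.mem_iff_areTwins hM hx).trans (hQ.mem_iff_areTwins hN hxN).symm
  exact hMN ▸ hN

/-- A connected graph admits at most one reduced complete-empty join decomposition. -/
theorem reducedCEDecomp_unique {α : Type*} (Γ : SimpleGraph α) (hconn : Γ.Connected)
    (P₁ P₂ : Set (Set α)) (h₁ : IsReducedCEDecomp Γ P₁) (h₂ : IsReducedCEDecomp Γ P₂) :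
    P₁ = P₂ := by
  exact (h₁.subset h₂).antisymm (h₂.subset h₁)
end
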